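/- arXiv:2007.01431 — 2 statements merged into one kernel-verified Lean document; each statement's English description precedes it below -/
import Mathlib

section
/- For every n ≥ 1, the complete graph K_n is gap-vertex-labelable if and only if n ≤ 3. -/
/-- The neighbourhood of `v` in `G` as a `Finset` (classically decidable). -/
noncomputable def gapNbhd {V : Type*} [Fintype V] (G : SimpleGraph V) (v : V) : Finset V :=
  @Finset.filter V (fun u => G.Adj v u) (Classical.decPred _) Finset.univ

/-- The colouring induced by a vertex-labelling `π` : a vertex with at least two neighbours
gets the gap `max − min` of the labels of its neighbours, a vertex with exactly one neighbour
`u` gets `π u`, and an isolated vertex gets `1`. -/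
noncomputable def gapColor {V : Type*} [Fintype V] (G : SimpleGraph V) (π : V → ℕ) (v : V) : ℕ :=
  if h : ((gapNbhd G v).image π).Nonempty then
    if 2 ≤ (gapNbhd G v).card then
      ((gapNbhd G v).image π).max' h - ((gapNbhd G v).image π).min' h
    else ((gapNbhd G v).image π).max' h
  else 1

/-- `π` is a gap-`[k]`-vertex-labelling of `G`: the labels lie in `{1, …, k}` and the induced
colouring is proper. -/
def IsGapLabelling {V : Type*} [Fintype V] (G : SimpleGraph V) (k : ℕ) (π : V → ℕ) : Prop :=
  (∀ v, 1 ≤ π v ∧ π v ≤ k) ∧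
  ∀ u v, G.Adj u v → gapColor G π u ≠ gapColor G π v

/-- `G` is gap-vertex-labelable if it admits a gap-`[k]`-vertex-labelling for some `k ≥ 1`. -/
def GapVertexLabelable {V : Type*} [Fintype V] (G : SimpleGraph V) : Prop :=
  ∃ k, 1 ≤ k ∧ ∃ π, IsGapLabelling G k π

/-- The vertex-gap number: the least `k ≥ 1` for which `G` admits a
gap-`[k]`-vertex-labelling. -/
noncomputable def vertexGapNumber {V : Type*} [Fintype V] (G : SimpleGraph V) : ℕ :=
  sInf {k | 1 ≤ k ∧ ∃ π, IsGapLabelling G k π}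

theorem mem_gapNbhd {V : Type*} [Fintype V] {G : SimpleGraph V} {v u : V} :
    u ∈ gapNbhd G v ↔ G.Adj v u := by
  simp [gapNbhd]

/-- The colour of a vertex with two distinct neighbours `x`, `y`, whose neighbours attain their
least label at `a` and their greatest label at `b`. -/
theorem gapColor_eq_sub {V : Type*} [Fintype V] {G : SimpleGraph V} {π : V → ℕ} {v a b x y : V}
    (hx : G.Adj v x) (hy : G.Adj v y) (hxy : x ≠ y) (ha : G.Adj v a) (hb : G.Adj v b)
    (hmin : ∀ u, G.Adj v u → π a ≤ π u) (hmax : ∀ u, G.Adj v u → π u ≤ π b) :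
    gapColor G π v = π b - π a := by
  classical
  have hne : ((gapNbhd G v).image π).Nonempty :=
    ⟨π a, Finset.mem_image_of_mem π (mem_gapNbhd.2 ha)⟩
  have hcard : 2 ≤ (gapNbhd G v).card :=
    Finset.one_lt_card.2 ⟨x, mem_gapNbhd.2 hx, y, mem_gapNbhd.2 hy, hxy⟩
  have hM : ((gapNbhd G v).image π).max' hne = π b := by
    refine (Finset.max'_eq_iff _ _ _).2 ⟨Finset.mem_image_of_mem π (mem_gapNbhd.2 hb), ?_⟩
    simpa [mem_gapNbhd] using hmax
  have hm : ((gapNbhd G v).image π).min' hne = π a := by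
    refine (Finset.min'_eq_iff _ _ _).2 ⟨Finset.mem_image_of_mem π (mem_gapNbhd.2 ha), ?_⟩
    simpa [mem_gapNbhd] using hmin
  rw [gapColor, dif_pos hne, if_pos hcard, hM, hm]

/-- The colour of a vertex with exactly one neighbour is the label of that neighbour. -/
theorem gapColor_eq_of_unique_neighbour {V : Type*} [Fintype V] {G : SimpleGraph V} {π : V → ℕ}
    {v u : V} (h : ∀ w, G.Adj v w ↔ w = u) : gapColor G π v = π u := by
  have hs : gapNbhd G v = {u} := by
    ext w
    simp [mem_gapNbhd, h]
  simp [gapColor, hs]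

/-- In a complete graph on at least four vertices, two vertices that avoid a vertex of least label
and a vertex of greatest label receive the same colour. -/
theorem not_gapVertexLabelable_top {V : Type*} [Fintype V] (hV : 4 ≤ Fintype.card V) :
    ¬ GapVertexLabelable (⊤ : SimpleGraph V) := by
  classical
  rintro ⟨k, -, π, -, hπ⟩
  have : Nonempty V := Fintype.card_pos_iff.1 (by omega)
  obtain ⟨a, ha⟩ := Finite.exists_min π
  obtain ⟨b, hb⟩ := Finite.exists_max π
  have hcard : 1 < (({a, b} : Finset V)ᶜ).card := by
    have := Finset.card_le_two (a := a) (b := b)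
    rw [Finset.card_compl]
    omega
  obtain ⟨c, hc, d, hd, hcd⟩ := Finset.one_lt_card.1 hcard
  simp only [Finset.mem_compl, Finset.mem_insert, Finset.mem_singleton, not_or] at hc hd
  refine hπ c d hcd ?_
  rw [gapColor_eq_sub (x := d) (y := a) (a := a) (b := b) hcd hc.1 hd.1 hc.1 hc.2
      (fun u _ => ha u) (fun u _ => hb u),
    gapColor_eq_sub (x := c) (y := a) (a := a) (b := b) hcd.symm hd.1 hc.1 hd.1 hd.2
      (fun u _ => ha u) (fun u _ => hb u)]

/-- The complete graph `K_n` is gap-vertex-labelable iff `n ≤ 3`. -/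
theorem completeGraph_gapVertexLabelable_iff (n : ℕ) (hn : 1 ≤ n) :
    GapVertexLabelable (⊤ : SimpleGraph (Fin n)) ↔ n ≤ 3 := by
  constructor
  · intro h
    by_contra! hlt
    exact not_gapVertexLabelable_top (by rwa [Fintype.card_fin]) h
  · intro h
    obtain rfl | rfl | rfl : n = 1 ∨ n = 2 ∨ n = 3 := by omega
    · exact ⟨1, le_rfl, fun _ => 1, fun _ => ⟨le_rfl, le_rfl⟩,
        fun u v huv => absurd (Subsingleton.elim u v) huv.ne⟩
    · refine ⟨2, by norm_num, ![1, 2], by decide, ?_⟩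
      have h0 : gapColor (⊤ : SimpleGraph (Fin 2)) ![1, 2] 0 = 2 :=
        gapColor_eq_of_unique_neighbour (u := 1) (by decide)
      have h1 : gapColor (⊤ : SimpleGraph (Fin 2)) ![1, 2] 1 = 1 :=
        gapColor_eq_of_unique_neighbour (u := 0) (by decide)
      intro u v huv
      fin_cases u <;> fin_cases v <;> simp_all
    · refine ⟨4, by norm_num, ![1, 2, 4], by decide, ?_⟩
      have h0 : gapColor (⊤ : SimpleGraph (Fin 3)) ![1, 2, 4] 0 = 2 :=
        gapColor_eq_sub (x := 1) (y := 2) (a := 1) (b := 2) (by decide) (by decide) (by decide)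
          (by decide) (by decide) (by decide) (by decide)
      have h1 : gapColor (⊤ : SimpleGraph (Fin 3)) ![1, 2, 4] 1 = 3 :=
        gapColor_eq_sub (x := 0) (y := 2) (a := 0) (b := 2) (by decide) (by decide) (by decide)
          (by decide) (by decide) (by decide) (by decide)
      have h2 : gapColor (⊤ : SimpleGraph (Fin 3)) ![1, 2, 4] 2 = 1 :=
        gapColor_eq_sub (x := 0) (y := 1) (a := 0) (b := 1) (by decide) (by decide) (by decide)
          (by decide) (by decide) (by decide) (by decide)
      intro u v huv
      fin_cases u <;> fin_cases v <;> simp_all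
end

section
/- No simple graph on 6 vertices with at least 13 edges is gap-vertex-labelable; that is, removing at most two edges from the complete graph K_6 never yields a gap-vertex-labelable graph. Since the graph obtained from K_6 by removing a perfect matching (which is C_6^2) is gap-vertex-labelable, the gap-strength of K_6 equals 3. -/
/-- The gap-strength of `G`: the least number `l` such that some graph obtained from `G` by
removing `l` edges is gap-vertex-labelable. -/
noncomputable def gapStrength {V : Type*} [Fintype V] (G : SimpleGraph V) : ℕ :=
  sInf {l | ∃ H : SimpleGraph V, H ≤ G ∧ H.edgeSet.ncard + l = G.edgeSet.ncard ∧
    GapVertexLabelable H}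

/-- The `k`-th power of the cycle on `n` vertices. -/
def cyclePower (n k : ℕ) : SimpleGraph (Fin n) :=
  SimpleGraph.fromRel
    (fun i j => i.val ≤ j.val ∧ (j.val - i.val ≤ k ∨ n - (j.val - i.val) ≤ k))

theorem gapColor_eq_sub_s13 {V : Type*} [Fintype V] {G : SimpleGraph V} {π : V → ℕ} {u m M : V}
    (hm : G.Adj u m) (hM : G.Adj u M) (hne : m ≠ M)
    (h : ∀ w, G.Adj u w → π m ≤ π w ∧ π w ≤ π M) : gapColor G π u = π M - π m := by
  classical
  have mem : ∀ w, w ∈ gapNbhd G u ↔ G.Adj u w := fun w => by simp [gapNbhd]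
  have himg : ((gapNbhd G u).image π).Nonempty :=
    ⟨π m, Finset.mem_image_of_mem π ((mem m).2 hm)⟩
  have hcard : 2 ≤ (gapNbhd G u).card :=
    Finset.one_lt_card.2 ⟨m, (mem m).2 hm, M, (mem M).2 hM, hne⟩
  have hmax : ((gapNbhd G u).image π).max' himg = π M := by
    refine le_antisymm (Finset.max'_le _ _ _ fun y hy => ?_)
      (Finset.le_max' _ _ (Finset.mem_image_of_mem π ((mem M).2 hM)))
    obtain ⟨w, hw, rfl⟩ := Finset.mem_image.1 hy
    exact (h w ((mem w).1 hw)).2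
  have hmin : ((gapNbhd G u).image π).min' himg = π m := by
    refine le_antisymm (Finset.min'_le _ _ (Finset.mem_image_of_mem π ((mem m).2 hm)))
      (Finset.le_min' _ _ _ fun y hy => ?_)
    obtain ⟨w, hw, rfl⟩ := Finset.mem_image.1 hy
    exact (h w ((mem w).1 hw)).1
  rw [gapColor, dif_pos himg, if_pos hcard, hmax, hmin]

theorem exists_ne_forall_le_and_le {V : Type*} [Finite V] [Nontrivial V] (π : V → ℕ) :
    ∃ m M, m ≠ M ∧ ∀ w, π m ≤ π w ∧ π w ≤ π M := by
  obtain ⟨m, hm⟩ := Finite.exists_min π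
  obtain ⟨M, hM⟩ := Finite.exists_max π
  by_cases hne : m = M
  · subst hne
    obtain ⟨x, hx⟩ := exists_ne m
    exact ⟨m, x, hx.symm, fun w => ⟨hm w, (hM w).trans (hm x)⟩⟩
  · exact ⟨m, M, hne, fun w => ⟨hm w, hM w⟩⟩

/-- For any pair `e` there is a vertex `x` such that no pair joining a vertex other than `m`, `M`, `x`
to `m`, to `M` or to another such vertex equals `e`. -/
theorem exists_endpoint_avoiding {V : Type*} (m M : V) (e : Sym2 V) :
    ∃ x, ∀ u, u ≠ m → u ≠ M → u ≠ x →
      s(u, m) ≠ e ∧ s(u, M) ≠ e ∧ ∀ v, v ≠ m → v ≠ M → v ≠ x → s(u, v) ≠ e := by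
  classical
  induction e with
  | _ p q =>
    refine ⟨if p = m ∨ p = M then q else p, fun u hm hM hx => ?_⟩
    simp only [ne_eq, Sym2.eq_iff]
    split_ifs at hx ⊢ <;> grind

/-- Deleting at most two edges from a complete graph on at least six vertices leaves, for any two
vertices, an edge joining common neighbours of them. -/
theorem exists_adj_common_neighbors {V : Type*} [Fintype V] (hV : 6 ≤ Fintype.card V)
    {G : SimpleGraph V} {e₁ e₂ : Sym2 V}
    (hG : ∀ u v, u ≠ v → s(u, v) ≠ e₁ → s(u, v) ≠ e₂ → G.Adj u v)
    (m M : V) :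
    ∃ u v, G.Adj u v ∧ G.Adj u m ∧ G.Adj u M ∧ G.Adj v m ∧ G.Adj v M := by
  classical
  obtain ⟨x, hx⟩ := exists_endpoint_avoiding m M e₁
  obtain ⟨y, hy⟩ := exists_endpoint_avoiding m M e₂
  have hcard : 1 < (({m, M, x, y} : Finset V)ᶜ).card := by
    have := Finset.card_le_four (a := m) (b := M) (c := x) (d := y)
    rw [Finset.card_compl]
    omega
  obtain ⟨u, hu, v, hv, huv⟩ := Finset.one_lt_card.1 hcard
  simp only [Finset.mem_compl, Finset.mem_insert, Finset.mem_singleton, not_or] at hu hv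
  obtain ⟨hum, huM, hux, huy⟩ := hu
  obtain ⟨hvm, hvM, hvx, hvy⟩ := hv
  obtain ⟨a₁, a₂, a₃⟩ := hx u hum huM hux
  obtain ⟨b₁, b₂, b₃⟩ := hy u hum huM huy
  obtain ⟨c₁, c₂, -⟩ := hx v hvm hvM hvx
  obtain ⟨d₁, d₂, -⟩ := hy v hvm hvM hvy
  exact ⟨u, v, hG _ _ huv (a₃ v hvm hvM hvx) (b₃ v hvm hvM hvy), hG _ _ hum a₁ b₁,
    hG _ _ huM a₂ b₂, hG _ _ hvm c₁ d₁, hG _ _ hvM c₂ d₂⟩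

theorem ncard_edgeSet_top_fin_six : (⊤ : SimpleGraph (Fin 6)).edgeSet.ncard = 15 := by
  rw [← SimpleGraph.coe_edgeFinset, Set.ncard_coe_finset,
    SimpleGraph.card_edgeFinset_top_eq_card_choose_two]
  decide

theorem not_gapVertexLabelable_of_thirteen_le {G : SimpleGraph (Fin 6)}
    (hG : 13 ≤ G.edgeSet.ncard) : ¬ GapVertexLabelable G := by
  classical
  rintro ⟨k, -, π, -, hπ⟩
  have hle : ((⊤ : SimpleGraph (Fin 6)).edgeFinset \ G.edgeFinset).card ≤ 2 := by
    rw [Finset.card_sdiff_of_subset (SimpleGraph.edgeFinset_mono le_top)]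
    have h₁ := ncard_edgeSet_top_fin_six
    rw [← SimpleGraph.coe_edgeFinset, Set.ncard_coe_finset] at h₁ hG
    omega
  obtain ⟨t, ht, ht₂⟩ := Finset.exists_superset_card_eq hle (by decide)
  obtain ⟨e₁, e₂, -, rfl⟩ := Finset.card_eq_two.1 ht₂
  obtain ⟨m, M, hne, hmM⟩ := exists_ne_forall_le_and_le π
  obtain ⟨u, v, huv, hum, huM, hvm, hvM⟩ := exists_adj_common_neighbors (G := G) (e₁ := e₁)
    (e₂ := e₂) (by simp) (fun u v h h₁ h₂ => by
      by_contra hn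
      have := @ht s(u, v) (by simp [h, hn])
      simp [h₁, h₂] at this) m M
  exact hπ u v huv ((gapColor_eq_sub_s13 hum huM hne fun w _ => hmM w).trans
    (gapColor_eq_sub_s13 hvm hvM hne fun w _ => hmM w).symm)

instance decidableRelCyclePowerAdj (n k : ℕ) : DecidableRel (cyclePower n k).Adj := by
  unfold cyclePower
  infer_instance

theorem gapVertexLabelable_cyclePower_six_two : GapVertexLabelable (cyclePower 6 2) := by
  have hcol : ∀ v, gapColor (cyclePower 6 2) ![1, 2, 4, 1, 2, 4] v = ![2, 3, 1, 2, 3, 1] v := by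
    intro v
    refine (gapColor_eq_sub_s13 (m := ![1, 0, 0, 1, 0, 0] v) (M := ![2, 2, 1, 2, 2, 1] v)
      ?_ ?_ ?_ ?_).trans ?_ <;> revert v <;> decide
  refine ⟨4, by decide, ![1, 2, 4, 1, 2, 4], by decide, fun u v huv => ?_⟩
  rw [hcol, hcol]
  revert u v
  decide

theorem ncard_edgeSet_cyclePower_six_two : (cyclePower 6 2).edgeSet.ncard = 12 := by
  rw [← SimpleGraph.coe_edgeFinset, Set.ncard_coe_finset]
  decide

/-- No simple graph on `6` vertices with at least `13` edges is gap-vertex-labelable, i.e.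
removing at most two edges from `K_6` never yields a gap-vertex-labelable graph; since
`C_6^2` (which is `K_6` minus a perfect matching) is gap-vertex-labelable, the gap-strength
of `K_6` equals `3`. -/
theorem gapStrength_K6 :
    (∀ G : SimpleGraph (Fin 6), 13 ≤ G.edgeSet.ncard → ¬ GapVertexLabelable G) ∧
      GapVertexLabelable (cyclePower 6 2) ∧
      gapStrength (⊤ : SimpleGraph (Fin 6)) = 3 := by
  refine ⟨fun G => not_gapVertexLabelable_of_thirteen_le, gapVertexLabelable_cyclePower_six_two,
    le_antisymm (Nat.sInf_le ⟨cyclePower 6 2, le_top, ?_, gapVertexLabelable_cyclePower_six_two⟩)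
      (le_csInf ⟨3, cyclePower 6 2, le_top, ?_, gapVertexLabelable_cyclePower_six_two⟩ ?_)⟩
  · rw [ncard_edgeSet_cyclePower_six_two, ncard_edgeSet_top_fin_six]
  · rw [ncard_edgeSet_cyclePower_six_two, ncard_edgeSet_top_fin_six]
  · rintro l ⟨H, -, hl, hH⟩
    rw [ncard_edgeSet_top_fin_six] at hl
    by_contra hlt
    exact not_gapVertexLabelable_of_thirteen_le (by omega) hH
end
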